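/- (Optimality / Pareto dominance of the optimal pair, Theorem 5(b) in Laplace-principle form.) Under the general setting with Assumption 1, for any continuous functions X : Z → X and u : Z → ℝ satisfying sup_{z∈Z} { ℓ( R(X(z), θ) − u(z) ) − I_θ(z) } ≤ −r for every θ ∈ Θ, it holds that u*(z) ≤ u(z) for every z ∈ Z. -/

import Mathlib

open Filter Topology Set
open scoped ENNReal Classical

noncomputable section

/-- The regret `R(x,θ) := c(x,θ) − min_{y∈X} c(y,θ)`. -/
def regretFn {E Θ : Type*} (c : E → Θ → ℝ) (X : Set E) (x : E) (θ : Θ) : ℝ :=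
  c x θ - sInf ((fun y => c y θ) '' X)

/-- The inner expression `R(x,θ) − ℓ⁻¹(I_θ(z) − r)` as an extended real number,
with the convention that it equals `−∞` whenever `I_θ(z) = ∞`. -/
def innerFn {E Θ Z : Type*} (c : E → Θ → ℝ) (X : Set E) (linv : ℝ → ℝ) (r : ℝ)
    (I : Θ → Z → ℝ≥0∞) (x : E) (θ : Θ) (z : Z) : EReal :=
  if I θ z = ∞ then ⊥
  else ((regretFn c X x θ - linv ((I θ z).toReal - r) : ℝ) : EReal)

/-- `G(x,z) := max_{θ∈Θ} { R(x,θ) − ℓ⁻¹(I_θ(z) − r) }` as a real number. -/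
def Gfn {E Θ Z : Type*} (c : E → Θ → ℝ) (X : Set E) (linv : ℝ → ℝ) (r : ℝ)
    (I : Θ → Z → ℝ≥0∞) (x : E) (z : Z) : ℝ :=
  (⨆ θ : Θ, innerFn c X linv r I x θ z).toReal

/-- `u*(z) := min_{x∈X} G(x,z)`. -/
def ustarFn {E Θ Z : Type*} (c : E → Θ → ℝ) (X : Set E) (linv : ℝ → ℝ) (r : ℝ)
    (I : Θ → Z → ℝ≥0∞) (z : Z) : ℝ :=
  sInf ((fun x => Gfn c X linv r I x z) '' X)

lemma regretFn_nonneg {E Θ : Type*} {c : E → Θ → ℝ} {X : Set E} {x : E} {θ : Θ}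
    (hbdd : BddBelow ((fun y => c y θ) '' X)) (hx : x ∈ X) : 0 ≤ regretFn c X x θ :=
  sub_nonneg.2 (csInf_le hbdd (mem_image_of_mem _ hx))

lemma le_iSup_innerFn {E Θ Z : Type*} {c : E → Θ → ℝ} {X : Set E} {linv : ℝ → ℝ} {r : ℝ}
    {I : Θ → Z → ℝ≥0∞} {x : E} {θ : Θ} {z : Z} (hθ : I θ z ≠ ∞) :
    ((regretFn c X x θ - linv ((I θ z).toReal - r) : ℝ) : EReal) ≤
      ⨆ θ : Θ, innerFn c X linv r I x θ z := by
  refine le_iSup_of_le θ ?_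
  rw [innerFn, if_neg hθ]

/-- `Gfn` is bounded below on `X`, even where the supremum defining it is infinite. -/
lemma bddBelow_Gfn_image {E Θ Z : Type*} {c : E → Θ → ℝ} {X : Set E} {linv : ℝ → ℝ} {r : ℝ}
    {I : Θ → Z → ℝ≥0∞} {θ : Θ} {z : Z} (hbdd : BddBelow ((fun y => c y θ) '' X))
    (hθ : I θ z ≠ ∞) : BddBelow ((fun x => Gfn c X linv r I x z) '' X) := by
  refine ⟨min 0 (-linv ((I θ z).toReal - r)), ?_⟩
  rintro _ ⟨x, hx, rfl⟩
  change _ ≤ (⨆ θ : Θ, innerFn c X linv r I x θ z).toReal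
  by_cases htop : (⨆ θ : Θ, innerFn c X linv r I x θ z) = ⊤
  · simp [htop]
  · have h := EReal.toReal_le_toReal
      (le_iSup_innerFn (c := c) (X := X) (linv := linv) (r := r) (x := x) hθ)
      (EReal.coe_ne_bot _) htop
    rw [EReal.toReal_coe] at h
    have hR := regretFn_nonneg hbdd hx
    exact (min_le_right _ _).trans (by linarith)

/-- A decision whose regret above `a` is penalized feasibly at `z` has `G(x,z) ≤ a`. -/
lemma Gfn_le_of_feasible {E Θ Z : Type*} {c : E → Θ → ℝ} {X : Set E} {ℓ linv : ℝ → ℝ}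
    (hℓmono : StrictMono ℓ) (hlinv : ∀ y, ℓ (linv y) = y) {r a : ℝ}
    {I : Θ → Z → ℝ≥0∞} {x : E} {z : Z} (hI : ∃ θ : Θ, I θ z ≠ ∞)
    (hfeas : ∀ θ, I θ z ≠ ∞ → ℓ (regretFn c X x θ - a) - (I θ z).toReal ≤ -r) :
    Gfn c X linv r I x z ≤ a := by
  obtain ⟨θ₀, hθ₀⟩ := hI
  have hle : (⨆ θ : Θ, innerFn c X linv r I x θ z) ≤ (a : EReal) := by
    refine iSup_le fun θ => ?_
    rw [innerFn]
    split_ifs with hθ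
    · exact bot_le
    · have h : regretFn c X x θ - a ≤ linv ((I θ z).toReal - r) := by
        rw [← hℓmono.le_iff_le, hlinv]
        linarith [hfeas θ hθ]
      exact EReal.coe_le_coe_iff.2 (by linarith)
  have hbot := ne_bot_of_le_ne_bot (EReal.coe_ne_bot _)
    (le_iSup_innerFn (c := c) (X := X) (linv := linv) (r := r) (x := x) hθ₀)
  simpa [Gfn] using EReal.toReal_le_toReal hle hbot (EReal.coe_ne_top a)

/-- Theorem 5(b), Laplace-principle form: `(X*, u*)` Pareto dominates every
feasible pair: if continuous `X : Z → X` and `u : Z → ℝ` satisfy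
`sup_{z∈Z} { ℓ(R(X(z),θ) − u(z)) − I_θ(z) } ≤ −r` for every `θ ∈ Θ`, then
`u*(z) ≤ u(z)` for every `z ∈ Z`. -/
theorem ustar_pareto_dominant
    {E Θ Z : Type*} [NormedAddCommGroup E] [NormedSpace ℝ E]
    [MetricSpace Θ] [CompactSpace Θ] [Nonempty Θ]
    [MetricSpace Z] [Nonempty Z]
    (X : Set E) (hXcomp : IsCompact X) (hXconv : Convex ℝ X) (hXne : X.Nonempty)
    (c : E → Θ → ℝ)
    (hc : ContinuousOn (fun p : E × Θ => c p.1 p.2) (X ×ˢ univ))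
    (hcconv : ∀ θ : Θ, StrictConvexOn ℝ X fun x => c x θ)
    (ℓ : ℝ → ℝ) (hℓcont : Continuous ℓ) (hℓmono : StrictMono ℓ)
    (hℓbij : Function.Bijective ℓ) (hℓ0 : ℓ 0 = 0)
    (linv : ℝ → ℝ) (hlinv : ∀ y, ℓ (linv y) = y) (hlinv' : ∀ y, linv (ℓ y) = y)
    (r : ℝ) (hr : 0 < r)
    (I : Θ → Z → ℝ≥0∞)
    (hI1 : ∀ z : Z, ∃ θ : Θ, I θ z ≠ ∞)
    (hI2 : LowerSemicontinuous fun p : Θ × Z => I p.1 p.2)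
    (hI3 : ∀ (θ : Θ) (z : Z), I θ z ≠ ∞ → ∀ zs : ℕ → Z, Tendsto zs atTop (𝓝 z) →
      ∃ θs : ℕ → Θ, Tendsto θs atTop (𝓝 θ) ∧
        Tendsto (fun n => I (θs n) (zs n)) atTop (𝓝 (I θ z)))
    (Xf : Z → E) (hXfcont : Continuous Xf) (hXfmem : ∀ z : Z, Xf z ∈ X)
    (u : Z → ℝ) (hucont : Continuous u)
    (hfeas : ∀ θ : Θ,
      (⨆ z : Z, if I θ z = ∞ then (⊥ : EReal)
        else ((ℓ (regretFn c X (Xf z) θ - u z) - (I θ z).toReal : ℝ) : EReal))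
        ≤ ((-r : ℝ) : EReal)) :
    ∀ z : Z, ustarFn c X linv r I z ≤ u z := by
  intro z
  obtain ⟨θ₀, hθ₀⟩ := hI1 z
  have hcont : ContinuousOn (fun y => c y θ₀) X :=
    hc.comp (f := fun y => (y, θ₀)) (by fun_prop) fun y hy => ⟨hy, mem_univ θ₀⟩
  refine (csInf_le (bddBelow_Gfn_image (hXcomp.bddBelow_image hcont) hθ₀)
    (mem_image_of_mem _ (hXfmem z))).trans ?_
  refine Gfn_le_of_feasible hℓmono hlinv (hI1 z) fun θ hθ => ?_
  have h := (le_iSup (fun z : Z => if I θ z = ∞ then (⊥ : EReal)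
    else ((ℓ (regretFn c X (Xf z) θ - u z) - (I θ z).toReal : ℝ) : EReal)) z).trans (hfeas θ)
  rw [if_neg hθ] at h
  exact EReal.coe_le_coe_iff.1 h

end
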